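/- Suppose at least one suspicious type exists, and let u = ∑_{A_{−i} ∈ (X×Z)^{n−1}} min(1, B/(|G(A_{−i})| + 1)) · ∏_{j ≠ i} h(a_j). Then for every audit policy φ, the incentive to lie satisfies ε(φ) ≥ 1 − (1 + c) · u. -/

import Mathlib

/-!
Threshold allocation model: `n` agents with types in `X × Z` (`X` verifiable,
`Z` self-reported), types drawn i.i.d. from a pmf `h`, score `f`, threshold `θ`,
audit budget `B`, penalty `c`.
-/

open Finset
open scoped Classical

noncomputable section

variable {X Z : Type*} [Fintype X] [Fintype Z] [Nonempty X] [Nonempty Z]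

/-- `h` is a probability mass function on `X × Z`. -/
def IsPmf (h : X × Z → ℝ) : Prop :=
  (∀ a, 0 ≤ h a) ∧ ∑ a : X × Z, h a = 1

/-- The `n`-agent profile obtained from the profile `am` of the agents other
than `i` by inserting `a` in slot `i` (denoted `A₋ᵢ ∪ᵢ {a}` in the paper). -/
def ins {n : ℕ} (i : Fin n) (am : {j : Fin n // j ≠ i} → X × Z) (a : X × Z) :
    Fin n → X × Z :=
  fun j => if hj : j = i then a else am ⟨j, hj⟩

/-- A report `a' = (x, z')` is suspicious: it has positive probability, scores at
or above the threshold, and some positive-probability type with the same `x`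
scores below the threshold. -/
def Suspicious (h f : X × Z → ℝ) (θ : ℝ) (a : X × Z) : Prop :=
  0 < h a ∧ θ ≤ f a ∧ ∃ z : Z, 0 < h (a.1, z) ∧ f (a.1, z) < θ

/-- `G A` is the set of indices of suspicious reports in the profile `A`. -/
def G {n : ℕ} (h f : X × Z → ℝ) (θ : ℝ) (A : Fin n → X × Z) : Finset (Fin n) :=
  univ.filter fun i => Suspicious h f θ (A i)

/-- An audit policy assigns to each profile a vector in `[0,1]^n` whose
suspicious coordinates sum to at most the budget `B`. -/
def IsAuditPolicy {n : ℕ} (h f : X × Z → ℝ) (θ B : ℝ)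
    (φ : (Fin n → X × Z) → Fin n → ℝ) : Prop :=
  ∀ A : Fin n → X × Z,
    (∀ i, φ A i ∈ Set.Icc (0 : ℝ) 1) ∧ ∑ i ∈ G h f θ A, φ A i ≤ B

/-- Expected gain of agent `i` with true type `a` reporting `a'` (when the others
report their true types, drawn i.i.d. from `h`), under audit policy `φ`. -/
def gain {n : ℕ} (h f : X × Z → ℝ) (θ c : ℝ)
    (φ : (Fin n → X × Z) → Fin n → ℝ) (i : Fin n) (a a' : X × Z) : ℝ :=
  if a' = a then 0
  else
    (∑ am : {j : Fin n // j ≠ i} → X × Z,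
        (∏ j, h (am j)) *
          ((if θ ≤ f a' then (1 : ℝ) else 0) * (1 - φ (ins i am a') i)
            - c * φ (ins i am a') i))
      - (if θ ≤ f a then (1 : ℝ) else 0)

/-- The incentive to lie under policy `φ`: the largest expected gain of any
misreport `a' = (x, z')` by any agent `i` with any true type `a = (x, z)` of
positive probability. -/
def eps {n : ℕ} (h f : X × Z → ℝ) (θ c : ℝ)
    (φ : (Fin n → X × Z) → Fin n → ℝ) : ℝ :=
  sSup {g : ℝ | ∃ (i : Fin n) (a : X × Z) (z' : Z),
    0 < h a ∧ g = gain h f θ c φ i a (a.1, z')}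

/-- The UNIFORM audit policy: audit each suspicious report with probability
`min 1 (B / |G(A)|)`, each sure-lie (`h (A i) = 0`) with probability `1`, and
everyone else with probability `0`. -/
def uniformPolicy {n : ℕ} (h f : X × Z → ℝ) (θ B : ℝ) :
    (Fin n → X × Z) → Fin n → ℝ :=
  fun A i =>
    if Suspicious h f θ (A i) then min 1 (B / ((G h f θ A).card : ℝ))
    else if h (A i) = 0 then 1 else 0

section Profiles

variable {X Z : Type*} {n : ℕ}

lemma ins_self (i : Fin n) (am : {j : Fin n // j ≠ i} → X × Z) (a : X × Z) :
    ins i am a i = a := by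
  simp [ins]

lemma ins_of_ne (i : Fin n) (am : {j : Fin n // j ≠ i} → X × Z) (a : X × Z)
    (j : {j : Fin n // j ≠ i}) : ins i am a j = am j := by
  simp [ins, j.2]

lemma prod_ins (h : X × Z → ℝ) (i : Fin n) (am : {j : Fin n // j ≠ i} → X × Z)
    (a : X × Z) : ∏ j, h (ins i am a j) = h a * ∏ j, h (am j) := by
  rw [Fintype.prod_eq_mul_prod_subtype_ne _ i]
  simp only [ins_self, ins_of_ne]

lemma card_G_ins {h f : X × Z → ℝ} {θ : ℝ} (i : Fin n)
    (am : {j : Fin n // j ≠ i} → X × Z) {a : X × Z} (ha : Suspicious h f θ a) :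
    (G h f θ (ins i am a)).card =
      (univ.filter fun j : {j : Fin n // j ≠ i} => Suspicious h f θ (am j)).card + 1 := by
  rw [G, card_filter, card_filter, Fintype.sum_eq_add_sum_subtype_ne _ i]
  simp only [ins_self, ins_of_ne, ha, if_true]
  rw [add_comm]

/-- The uniform policy exhausts as much of the budget on suspicious reports as any
policy can. -/
lemma sum_G_le_sum_G_uniformPolicy {h f : X × Z → ℝ} {θ B : ℝ}
    {φ : (Fin n → X × Z) → Fin n → ℝ} (hφ : IsAuditPolicy h f θ B φ) (A : Fin n → X × Z) :
    ∑ i ∈ G h f θ A, φ A i ≤ ∑ i ∈ G h f θ A, uniformPolicy h f θ B A i := by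
  have hunif : ∑ i ∈ G h f θ A, uniformPolicy h f θ B A i =
      (G h f θ A).card * min 1 (B / ((G h f θ A).card : ℝ)) := by
    rw [← nsmul_eq_mul, ← sum_const]
    refine sum_congr rfl fun i hi => ?_
    rw [uniformPolicy, if_pos (mem_filter.mp hi).2]
  rw [hunif]
  rcases (G h f θ A).eq_empty_or_nonempty with hG | hG
  · simp [hG]
  have hpos : (0 : ℝ) < (G h f θ A).card := by exact_mod_cast hG.card_pos
  rw [mul_min_of_nonneg _ _ hpos.le, mul_one, mul_div_cancel₀ _ hpos.ne']
  refine le_min ?_ (hφ A).2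
  simpa using sum_le_card_nsmul (G h f θ A) (φ A) 1 fun i _ => ((hφ A).1 i).2

variable [Fintype X] [Fintype Z]

/-- The probability that agent `i` is audited when reporting `a` while the others
report truthfully. -/
def auditProb (h : X × Z → ℝ) (φ : (Fin n → X × Z) → Fin n → ℝ) (i : Fin n)
    (a : X × Z) : ℝ :=
  ∑ am : {j : Fin n // j ≠ i} → X × Z, (∏ j, h (am j)) * φ (ins i am a) i

/-- The expected audit probability of a suspicious report of agent `i` under the
uniform policy. -/
def uniformAuditProb (h f : X × Z → ℝ) (θ B : ℝ) (i : Fin n) : ℝ :=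
  ∑ am : {j : Fin n // j ≠ i} → X × Z,
    min 1 (B / (((univ.filter fun j : {j : Fin n // j ≠ i} =>
        Suspicious h f θ (am j)).card : ℝ) + 1)) *
      ∏ j, h (am j)

lemma sum_profile_eq_sum_ins (i : Fin n) (F : (Fin n → X × Z) → ℝ) :
    ∑ A, F A = ∑ a : X × Z, ∑ am : {j : Fin n // j ≠ i} → X × Z, F (ins i am a) := by
  rw [← Fintype.sum_prod_type' (f := fun a am => F (ins i am a)),
    ← (Equiv.funSplitAt i (X × Z)).symm.sum_comp]
  refine Fintype.sum_congr _ _ fun p => congrArg F ?_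
  ext1 j
  by_cases hj : j = i
  · subst hj; simp [ins, Equiv.funSplitAt, Equiv.piSplitAt]
  · simp [ins, Equiv.funSplitAt, Equiv.piSplitAt, hj]

lemma sum_prod_pmf {ι : Type*} [Fintype ι] [DecidableEq ι] {h : X × Z → ℝ} (hpmf : IsPmf h) :
    ∑ am : ι → X × Z, ∏ j, h (am j) = 1 := by
  have := Finset.prod_univ_sum (fun _ : ι => (univ : Finset (X × Z))) (fun _ a => h a)
  rw [Fintype.piFinset_univ] at this
  rw [← this]
  simp [hpmf.2]

/-- Expected total audit probability of suspicious reports, computed agent by agent. -/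
lemma sum_profile_suspicious (h f : X × Z → ℝ) (θ : ℝ)
    (φ : (Fin n → X × Z) → Fin n → ℝ) :
    ∑ A : Fin n → X × Z, (∏ j, h (A j)) * ∑ i ∈ G h f θ A, φ A i =
      ∑ i, ∑ a ∈ univ.filter (Suspicious h f θ), h a * auditProb h φ i a := by
  simp only [G, sum_filter, mul_sum]
  rw [sum_comm]
  refine Fintype.sum_congr _ _ fun i => ?_
  rw [sum_profile_eq_sum_ins i]
  refine Fintype.sum_congr _ _ fun a => ?_
  simp only [ins_self, prod_ins]
  split_ifs
  · simp only [auditProb, mul_sum, mul_assoc]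
  · simp

lemma uniformAuditProb_eq (h f : X × Z → ℝ) (θ B : ℝ) (i k : Fin n) :
    uniformAuditProb h f θ B i = uniformAuditProb h f θ B k := by
  let e : {j : Fin n // j ≠ i} ≃ {j : Fin n // j ≠ k} :=
    (Equiv.swap i k).subtypeEquiv fun j => by
      rw [not_iff_not, Equiv.swap_apply_eq_iff, Equiv.swap_apply_right]
  unfold uniformAuditProb
  rw [← (e.arrowCongr (Equiv.refl (X × Z))).symm.sum_comp]
  refine Fintype.sum_congr _ _ fun am => ?_
  have hcard : (univ.filter fun j => Suspicious h f θ (am (e j))).card =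
      (univ.filter fun j => Suspicious h f θ (am j)).card := by
    rw [card_filter, card_filter]
    exact e.sum_comp fun j => if Suspicious h f θ (am j) then 1 else 0
  have hprod : ∏ j, h (am (e j)) = ∏ j, h (am j) := e.prod_comp fun j => h (am j)
  rw [← hcard, ← hprod]
  rfl

lemma auditProb_uniformPolicy {h f : X × Z → ℝ} {θ : ℝ} (B : ℝ) (i : Fin n) {a : X × Z}
    (ha : Suspicious h f θ a) :
    auditProb h (uniformPolicy h f θ B) i a = uniformAuditProb h f θ B i := by
  refine Fintype.sum_congr _ _ fun am => ?_
  simp only [uniformPolicy, ins_self, ha, if_true, card_G_ins i am ha, Nat.cast_add,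
    Nat.cast_one]
  rw [mul_comm]

lemma exists_auditProb_le {h f : X × Z → ℝ} {θ B : ℝ} (hpmf : IsPmf h)
    (hex : ∃ a : X × Z, Suspicious h f θ a) (i : Fin n)
    {φ : (Fin n → X × Z) → Fin n → ℝ} (hφ : IsAuditPolicy h f θ B φ) :
    ∃ (k : Fin n) (a : X × Z), Suspicious h f θ a ∧
      auditProb h φ k a ≤ uniformAuditProb h f θ B i := by
  have key : ∑ k, ∑ a ∈ univ.filter (Suspicious h f θ), h a * auditProb h φ k a ≤
      ∑ k : Fin n, ∑ a ∈ univ.filter (Suspicious h f θ),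
        h a * auditProb h (uniformPolicy h f θ B) k a := by
    rw [← sum_profile_suspicious, ← sum_profile_suspicious]
    exact sum_le_sum fun A _ => mul_le_mul_of_nonneg_left
      (sum_G_le_sum_G_uniformPolicy hφ A) (prod_nonneg fun j _ => hpmf.1 _)
  obtain ⟨k, -, hk⟩ := exists_le_of_sum_le ⟨i, mem_univ i⟩ key
  obtain ⟨a₀, ha₀⟩ := hex
  obtain ⟨a, ha, hle⟩ := exists_le_of_sum_le ⟨a₀, mem_filter.mpr ⟨mem_univ _, ha₀⟩⟩ hk
  have hs : Suspicious h f θ a := (mem_filter.mp ha).2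
  refine ⟨k, a, hs, ?_⟩
  rw [uniformAuditProb_eq h f θ B i k, ← auditProb_uniformPolicy B k hs]
  exact le_of_mul_le_mul_left hle hs.1

lemma gain_eq_one_sub_auditProb {h f : X × Z → ℝ} {θ : ℝ} (c : ℝ) (hpmf : IsPmf h)
    (φ : (Fin n → X × Z) → Fin n → ℝ) (i : Fin n) {a a' : X × Z}
    (ha : f a < θ) (ha' : θ ≤ f a') :
    gain h f θ c φ i a a' = 1 - (1 + c) * auditProb h φ i a' := by
  have hne : a' ≠ a := by rintro rfl; exact ha.not_ge ha'
  rw [gain, if_neg hne, if_neg ha.not_ge, sub_zero, auditProb, mul_sum,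
    eq_sub_iff_add_eq, ← sum_add_distrib]
  refine (Fintype.sum_congr _ _ fun am => ?_).trans (sum_prod_pmf hpmf)
  rw [if_pos ha']
  ring

lemma gain_le_eps {h : X × Z → ℝ} (f : X × Z → ℝ) (θ c : ℝ)
    (φ : (Fin n → X × Z) → Fin n → ℝ) (i : Fin n) {a : X × Z} (ha : 0 < h a) (z' : Z) :
    gain h f θ c φ i a (a.1, z') ≤ eps h f θ c φ := by
  refine le_csSup (Set.Finite.bddAbove ?_) ⟨i, a, z', ha, rfl⟩
  refine (Set.finite_range fun p : Fin n × (X × Z) × Z =>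
    gain h f θ c φ p.1 p.2.1 (p.2.1.1, p.2.2)).subset ?_
  rintro _ ⟨i, a, z', -, rfl⟩
  exact ⟨(i, a, z'), rfl⟩

end Profiles

/-- if a suspicious type exists then, writing `u` for the expected
uniform audit probability of a suspicious report, every audit policy `φ` has
incentive to lie at least `1 - (1 + c) * u`. -/
theorem eps_ge_one_sub_uniform {n : ℕ}
    (h f : X × Z → ℝ) (θ B c : ℝ)
    (hpmf : IsPmf h) (hB : 0 ≤ B) (hc : 0 ≤ c)
    (hex : ∃ a : X × Z, Suspicious h f θ a) (i : Fin n)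
    (φ : (Fin n → X × Z) → Fin n → ℝ) (hφ : IsAuditPolicy h f θ B φ) :
    1 - (1 + c) *
        ∑ am : {j : Fin n // j ≠ i} → X × Z,
          min 1 (B / (((univ.filter fun j : {j : Fin n // j ≠ i} =>
              Suspicious h f θ (am j)).card : ℝ) + 1)) *
            ∏ j, h (am j)
      ≤ eps h f θ c φ := by
  obtain ⟨k, a, hs, hle⟩ := exists_auditProb_le hpmf hex i hφ
  obtain ⟨-, hθ, z, hz, hzθ⟩ := hs
  refine le_trans ?_ (gain_le_eps f θ c φ k hz a.2)
  rw [gain_eq_one_sub_auditProb c hpmf φ k hzθ hθ]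
  exact sub_le_sub_left (mul_le_mul_of_nonneg_left hle (by linarith)) 1

end
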